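/- Let H be a Hilbert space and suppose tₑ → t weak-* in the trace-class operators N[H]. Then there exists a family of finite-rank orthogonal projections pₑ on H such that pₑ tₑ pₑ → t in trace norm, and qₑ tₑ qₑ → 0 weak-* in N[H], where qₑ = 1 − pₑ. -/

import Mathlib

open Filter Topology
open scoped RealInnerProductSpace

noncomputable section

variable {H H₁ H₂ : Type*}

/-- Trace of an operator along a Hilbert basis. -/
def traceAlong [NormedAddCommGroup H] [InnerProductSpace ℝ H] {ι : Type*}
    (b : HilbertBasis ι ℝ H) (s : H →L[ℝ] H) : ℝ :=
  ∑' i, ⟪s (b i), b i⟫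

/-- `t` is nuclear (trace-class) with nuclear (projective) norm at most `C`:
it admits a representation `t = Σ xᵢ ⊗ yᵢ` with `Σ ‖xᵢ‖‖yᵢ‖ ≤ C`. -/
def IsNuclearWith [NormedAddCommGroup H₁] [InnerProductSpace ℝ H₁]
    [NormedAddCommGroup H₂] [InnerProductSpace ℝ H₂]
    (C : ℝ) (t : H₁ →L[ℝ] H₂) : Prop :=
  ∃ (x : ℕ → H₂) (y : ℕ → H₁),
    Summable (fun i => ‖x i‖ * ‖y i‖) ∧ (∑' i, ‖x i‖ * ‖y i‖) ≤ C ∧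
      ∀ z : H₁, HasSum (fun i => ⟪y i, z⟫ • x i) (t z)

/-- `t` is a nuclear (trace-class) operator. -/
def IsNuclear [NormedAddCommGroup H₁] [InnerProductSpace ℝ H₁]
    [NormedAddCommGroup H₂] [InnerProductSpace ℝ H₂] (t : H₁ →L[ℝ] H₂) : Prop :=
  ∃ C, IsNuclearWith C t

/-- The nuclear (trace/projective) norm of `t`. -/
def nuclearNorm [NormedAddCommGroup H₁] [InnerProductSpace ℝ H₁]
    [NormedAddCommGroup H₂] [InnerProductSpace ℝ H₂] (t : H₁ →L[ℝ] H₂) : ℝ :=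
  sInf {C | IsNuclearWith C t}

/-- Weak-* convergence in `N[H] = K[H]*`: testing against every compact operator `q`
via the trace pairing `(q,t) ↦ Tr(q t)`. -/
def WeakStarTendstoN [NormedAddCommGroup H] [InnerProductSpace ℝ H] {ι : Type*}
    (b : HilbertBasis ι ℝ H) (ts : ℕ → H →L[ℝ] H) (t : H →L[ℝ] H) : Prop :=
  ∀ q : H →L[ℝ] H, IsCompactOperator q →
    Tendsto (fun n => traceAlong b (q ∘L ts n)) atTop (𝓝 (traceAlong b (q ∘L t)))

end

section

variable [NormedAddCommGroup H] [InnerProductSpace ℝ H] {α β : Type*}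

/-- `t = Σ xᵢ ⊗ yᵢ` with `Σ ‖xᵢ‖‖yᵢ‖ < ∞`, over an arbitrary index type. -/
def IsNuclearExpansion (x y : α → H) (t : H →L[ℝ] H) : Prop :=
  Summable (fun i => ‖x i‖ * ‖y i‖) ∧ ∀ z, HasSum (fun i => ⟪y i, z⟫ • x i) (t z)

theorem IsNuclear.exists_expansion {t : H →L[ℝ] H} (ht : IsNuclear t) :
    ∃ x y : ℕ → H, IsNuclearExpansion x y t := by
  obtain ⟨_, x, y, hs, -, hz⟩ := ht
  exact ⟨x, y, hs, hz⟩

namespace IsNuclearExpansion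

variable {x y : α → H} {t : H →L[ℝ] H}

theorem isNuclearWith [Countable α] (h : IsNuclearExpansion x y t) :
    IsNuclearWith (∑' i, ‖x i‖ * ‖y i‖) t := by
  obtain ⟨f, hf⟩ := exists_injective_nat α
  have hfun : (fun n => ‖Function.extend f x 0 n‖ * ‖Function.extend f y 0 n‖) =
      Function.extend f (fun i => ‖x i‖ * ‖y i‖) 0 := by
    funext n
    by_cases hn : ∃ i, f i = n
    · obtain ⟨i, rfl⟩ := hn
      simp [hf.extend_apply]
    · simp [Function.extend_apply' _ _ _ hn]
  have hsum := (hasSum_extend_zero hf).2 h.1.hasSum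
  rw [← hfun] at hsum
  refine ⟨Function.extend f x 0, Function.extend f y 0, hsum.summable, hsum.tsum_eq.le,
    fun z => ?_⟩
  convert! (hasSum_extend_zero hf).2 (h.2 z) using 1
  funext n
  by_cases hn : ∃ i, f i = n
  · obtain ⟨i, rfl⟩ := hn
    simp [hf.extend_apply]
  · simp [Function.extend_apply' _ _ _ hn]

theorem comp [CompleteSpace H] (h : IsNuclearExpansion x y t) (q r : H →L[ℝ] H) :
    IsNuclearExpansion (fun i => q (x i)) (fun i => r.adjoint (y i)) (q ∘L t ∘L r) := by
  refine ⟨(h.1.mul_left (‖q‖ * ‖r.adjoint‖)).of_nonneg_of_le (fun i => by positivity)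
    fun i => ?_, fun z => ?_⟩
  · calc ‖q (x i)‖ * ‖r.adjoint (y i)‖ ≤ (‖q‖ * ‖x i‖) * (‖r.adjoint‖ * ‖y i‖) := by
          gcongr <;> exact ContinuousLinearMap.le_opNorm _ _
      _ = _ := by ring
  · simpa [ContinuousLinearMap.adjoint_inner_left] using q.hasSum (h.2 (r z))

theorem comp_left [CompleteSpace H] (h : IsNuclearExpansion x y t) (q : H →L[ℝ] H) :
    IsNuclearExpansion (fun i => q (x i)) y (q ∘L t) := by
  simpa [ContinuousLinearMap.one_def, ContinuousLinearMap.adjoint_id] using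
    h.comp q (ContinuousLinearMap.id ℝ H)

end IsNuclearExpansion

theorem IsNuclearWith.add {C D : ℝ} {s t : H →L[ℝ] H} (hs : IsNuclearWith C s)
    (ht : IsNuclearWith D t) : IsNuclearWith (C + D) (s + t) := by
  obtain ⟨x, y, hxy, hC, hz⟩ := hs
  obtain ⟨x', y', hxy', hD, hz'⟩ := ht
  have hsum : HasSum (fun i : ℕ ⊕ ℕ => ‖Sum.elim x x' i‖ * ‖Sum.elim y y' i‖)
      ((∑' i, ‖x i‖ * ‖y i‖) + ∑' i, ‖x' i‖ * ‖y' i‖) :=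
    HasSum.sum hxy.hasSum hxy'.hasSum
  have h : IsNuclearExpansion (Sum.elim x x') (Sum.elim y y') (s + t) :=
    ⟨hsum.summable, fun z => HasSum.sum (hz z) (hz' z)⟩
  obtain ⟨X, Y, hXY, hle, hZ⟩ := h.isNuclearWith
  exact ⟨X, Y, hXY, hle.trans (by rw [hsum.tsum_eq]; gcongr), hZ⟩

theorem IsNuclearWith.nonneg {C : ℝ} {t : H →L[ℝ] H} (h : IsNuclearWith C t) : 0 ≤ C := by
  obtain ⟨x, y, -, hC, -⟩ := h
  exact (tsum_nonneg fun i => by positivity).trans hC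

theorem nuclearNorm_nonneg (t : H →L[ℝ] H) : 0 ≤ nuclearNorm t :=
  Real.sInf_nonneg fun _ h => IsNuclearWith.nonneg h

theorem IsNuclearWith.nuclearNorm_le {C : ℝ} {t : H →L[ℝ] H} (h : IsNuclearWith C t) :
    nuclearNorm t ≤ C :=
  csInf_le ⟨0, fun _ h => IsNuclearWith.nonneg h⟩ h

theorem sum_abs_inner_mul_inner_le (b : HilbertBasis β ℝ H) (u v : H) (s : Finset β) :
    ∑ j ∈ s, |⟪u, b j⟫ * ⟪b j, v⟫| ≤ ‖u‖ * ‖v‖ := by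
  calc ∑ j ∈ s, |⟪u, b j⟫ * ⟪b j, v⟫| = ∑ j ∈ s, ‖⟪b j, u⟫‖ * ‖⟪b j, v⟫‖ := by
        simp [abs_mul, real_inner_comm]
    _ ≤ √(∑ j ∈ s, ‖⟪b j, u⟫‖ ^ 2) * √(∑ j ∈ s, ‖⟪b j, v⟫‖ ^ 2) :=
        Real.sum_mul_le_sqrt_mul_sqrt _ _ _
    _ ≤ ‖u‖ * ‖v‖ := by
        gcongr <;> exact Real.sqrt_le_iff.2
          ⟨norm_nonneg _, b.orthonormal.sum_inner_products_le _⟩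

theorem IsNuclearExpansion.traceAlong_eq {x y : α → H} {t : H →L[ℝ] H}
    (h : IsNuclearExpansion x y t) (b : HilbertBasis β ℝ H) :
    traceAlong b t = ∑' i, ⟪x i, y i⟫ := by
  have hsum : Summable fun p : α × β => ⟪x p.1, b p.2⟫ * ⟪b p.2, y p.1⟫ := by
    refine Summable.of_abs ?_
    have hrow (i : α) : Summable fun j => |⟪x i, b j⟫ * ⟪b j, y i⟫| :=
      (b.summable_inner_mul_inner _ _).abs
    refine (summable_prod_of_nonneg fun _ => abs_nonneg _).2 ⟨hrow, ?_⟩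
    exact h.1.of_nonneg_of_le (fun i => tsum_nonneg fun j => abs_nonneg _) fun i =>
      (hrow i).tsum_le_of_sum_le fun s => sum_abs_inner_mul_inner_le b _ _ s
  calc traceAlong b t = ∑' j, ∑' i, ⟪x i, b j⟫ * ⟪b j, y i⟫ := by
        refine tsum_congr fun j => ?_
        have hj := (innerSL ℝ (b j)).hasSum (h.2 (b j))
        rw [real_inner_comm]
        refine hj.tsum_eq.symm.trans (tsum_congr fun i => ?_)
        simp [real_inner_comm, mul_comm]
    _ = ∑' i, ∑' j, ⟪x i, b j⟫ * ⟪b j, y i⟫ := Summable.tsum_comm hsum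
    _ = ∑' i, ⟪x i, y i⟫ := tsum_congr fun i => b.tsum_inner_mul_inner _ _

/-- For nuclear `t`, the functional `q ↦ Tr(q t)` is linear and bounded. -/
theorem IsNuclearExpansion.exists_traceFunctional [CompleteSpace H] {x y : α → H}
    {t : H →L[ℝ] H} (h : IsNuclearExpansion x y t) (b : HilbertBasis β ℝ H) :
    ∃ φ : (H →L[ℝ] H) →L[ℝ] ℝ, ∀ q, φ q = traceAlong b (q ∘L t) := by
  have hle (q : H →L[ℝ] H) (i : α) : ‖⟪q (x i), y i⟫‖ ≤ ‖q‖ * (‖x i‖ * ‖y i‖) :=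
    calc ‖⟪q (x i), y i⟫‖ ≤ ‖q (x i)‖ * ‖y i‖ := norm_inner_le_norm _ _
      _ ≤ (‖q‖ * ‖x i‖) * ‖y i‖ := by gcongr; exact q.le_opNorm _
      _ = _ := mul_assoc _ _ _
  have hs (q : H →L[ℝ] H) : Summable fun i => ⟪q (x i), y i⟫ :=
    (h.1.mul_left ‖q‖).of_norm_bounded (hle q)
  let f : (H →L[ℝ] H) →ₗ[ℝ] ℝ :=
    { toFun := fun q => ∑' i, ⟪q (x i), y i⟫
      map_add' := fun q r => by
        simp only [add_apply, inner_add_left]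
        exact (hs q).tsum_add (hs r)
      map_smul' := fun c q => by
        simp only [smul_apply, real_inner_smul_left, RingHom.id_apply, smul_eq_mul]
        exact tsum_mul_left }
  refine ⟨f.mkContinuous (∑' i, ‖x i‖ * ‖y i‖) fun q => ?_, fun q => ?_⟩
  · rw [mul_comm, ← tsum_mul_left]
    exact tsum_of_norm_bounded (h.1.mul_left ‖q‖).hasSum (hle q)
  · exact ((h.comp_left q).traceAlong_eq b).symm

theorem traceAlong_zero (b : HilbertBasis β ℝ H) : traceAlong b (0 : H →L[ℝ] H) = 0 := by
  simp [traceAlong]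

/-- Uniform boundedness on a closed subspace of a Banach space. -/
theorem banach_steinhaus_on_submodule {E F : Type*} [NormedAddCommGroup E] [NormedSpace ℝ E]
    [CompleteSpace E] [NormedAddCommGroup F] [NormedSpace ℝ F] {K : Submodule ℝ E}
    (hK : IsClosed (K : Set E)) (φ : α → E →L[ℝ] F)
    (h : ∀ q ∈ K, ∃ C, ∀ n, ‖φ n q‖ ≤ C) :
    ∃ M, 0 ≤ M ∧ ∀ n, ∀ q ∈ K, ‖φ n q‖ ≤ M * ‖q‖ := by
  have : CompleteSpace K := hK.completeSpace_coe
  obtain ⟨M, hM⟩ := banach_steinhaus (g := fun n => (φ n).comp K.subtypeL) fun q => h q q.2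
  refine ⟨max M 0, le_max_right _ _, fun n q hq => ?_⟩
  exact ((φ n).comp K.subtypeL).le_of_opNorm_le ((hM n).trans (le_max_left _ _)) ⟨q, hq⟩

/-- Uniform boundedness: the trace functionals of a weak-* convergent sequence of nuclear
operators are uniformly bounded on the compact operators. -/
theorem WeakStarTendstoN.exists_bound [CompleteSpace H] {b : HilbertBasis β ℝ H}
    {ts : ℕ → H →L[ℝ] H} {t : H →L[ℝ] H} (hts : ∀ n, IsNuclear (ts n))
    (hw : WeakStarTendstoN b ts t) :
    ∃ M, 0 ≤ M ∧ ∀ n, ∀ q : H →L[ℝ] H, IsCompactOperator q →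
      |traceAlong b (q ∘L ts n)| ≤ M * ‖q‖ := by
  choose x y hxy using fun n => (hts n).exists_expansion
  choose φ hφ using fun n => (hxy n).exists_traceFunctional b
  simp only [← hφ]
  refine banach_steinhaus_on_submodule (K := compactOperator (RingHom.id ℝ) H H)
    isClosed_setOfPred_isCompactOperator φ fun q hq => ?_
  obtain ⟨C, hC⟩ := (hw q hq).norm.bddAbove_range
  exact ⟨C, fun n => by simpa [hφ] using hC ⟨n, rfl⟩⟩

/-- A bounded sequence converging strongly to zero converges uniformly to zero on the image of
a compact operator. -/
theorem IsCompactOperator.tendsto_norm_comp {R : ℕ → H →L[ℝ] H} {C : ℝ}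
    (hC : ∀ k, ‖R k‖ ≤ C) (hR : ∀ z, Tendsto (fun k => R k z) atTop (𝓝 0)) {a : H →L[ℝ] H}
    (ha : IsCompactOperator a) : Tendsto (fun k => ‖R k ∘L a‖) atTop (𝓝 0) := by
  have hC0 : 0 ≤ C := (norm_nonneg _).trans (hC 0)
  have htb : TotallyBounded (a '' Metric.closedBall 0 1) :=
    ((isCompactOperator_iff_isCompact_closure_image_closedBall (a : H →ₗ[ℝ] H)
      zero_lt_one).1 ha).totallyBounded.subset subset_closure
  rw [Metric.tendsto_atTop]
  intro ε hε
  obtain ⟨F, hF, hcover⟩ := Metric.totallyBounded_iff.1 htb (ε / (4 * (C + 1))) (by positivity)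
  have hev : ∀ᶠ k in atTop, ∀ z ∈ F, ‖R k z‖ < ε / 4 :=
    (Filter.eventually_all_finite hF).2 fun z _ =>
      (hR z).norm.eventually_lt_const (by simpa using (by positivity : 0 < ε / 4))
  obtain ⟨N, hN⟩ := eventually_atTop.1 hev
  refine ⟨N, fun k hk => ?_⟩
  have hbound : ‖R k ∘L a‖ ≤ ε / 2 := by
    refine ContinuousLinearMap.opNorm_le_of_unit_norm (by positivity) fun u hu => ?_
    obtain ⟨z, hz, hdist⟩ := Set.mem_iUnion₂.1 (hcover ⟨u, by simp [hu], rfl⟩)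
    rw [Metric.mem_ball, dist_eq_norm] at hdist
    calc ‖R k (a u)‖ = ‖R k (a u - z) + R k z‖ := by simp
      _ ≤ ‖R k (a u - z)‖ + ‖R k z‖ := norm_add_le _ _
      _ ≤ C * (ε / (4 * (C + 1))) + ε / 4 := by
        gcongr
        · exact ((R k).le_of_opNorm_le (hC k) _).trans (by gcongr)
        · exact (hN k hk z hz).le
      _ ≤ ε / 2 := by
        have : C * (ε / (4 * (C + 1))) ≤ ε / 4 := by
          rw [mul_div_assoc', div_le_div_iff₀ (by positivity) (by positivity)]
          nlinarith
        linarith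
  rw [Real.dist_eq, sub_zero, abs_of_nonneg (norm_nonneg _)]
  linarith

/-- Countably many vectors lie in the union of an increasing sequence of finite-dimensional
subspaces. -/
theorem exists_monotone_finiteDimensional [Countable β] (z : β → H) :
    ∃ V : ℕ → Submodule ℝ H, Monotone V ∧ (∀ k, FiniteDimensional ℝ (V k)) ∧
      ∀ i, z i ∈ ⨆ k, V k := by
  obtain ⟨f, hf⟩ := exists_injective_nat β
  refine ⟨fun k => Submodule.span ℝ (z '' (f ⁻¹' Set.Iio k)), fun k l hkl => ?_, fun k => ?_,
    fun i => ?_⟩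
  · exact Submodule.span_mono (Set.image_mono fun i hi => lt_of_lt_of_le hi hkl)
  · exact FiniteDimensional.span_of_finite ℝ
      (((Set.finite_Iio k).preimage hf.injOn).image z)
  · exact Submodule.mem_iSup_of_mem (f i + 1)
      (Submodule.subset_span ⟨i, by simp, rfl⟩)

theorem WeakStarTendstoN.tendsto_inner [CompleteSpace H] {b : HilbertBasis β ℝ H}
    {ts : ℕ → H →L[ℝ] H} {t : H →L[ℝ] H} (hts : ∀ n, IsNuclear (ts n)) (ht : IsNuclear t)
    (hw : WeakStarTendstoN b ts t) (u v : H) :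
    Tendsto (fun n => ⟪u, ts n v⟫) atTop (𝓝 ⟪u, t v⟫) := by
  have key {s : H →L[ℝ] H} (hs : IsNuclear s) :
      traceAlong b (InnerProductSpace.rankOne ℝ v u ∘L s) = ⟪u, s v⟫ := by
    obtain ⟨x, y, h⟩ := hs.exists_expansion
    rw [(h.comp_left _).traceAlong_eq b]
    refine Eq.trans (tsum_congr fun i => ?_) ((innerSL ℝ u).hasSum (h.2 v)).tsum_eq
    simp [real_inner_smul_right, real_inner_comm, mul_comm]
  have hcomp : IsCompactOperator (InnerProductSpace.rankOne ℝ v u : H →L[ℝ] H) := by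
    rw [InnerProductSpace.rankOne_def']
    have : IsCompactOperator (innerSL ℝ u) :=
      isCompactOperator_of_locallyCompactSpace_dom (innerSL ℝ u)
    exact this.clm_comp (ContinuousLinearMap.toSpanSingleton ℝ v)
  simpa [key ht, fun n => key (hts n)] using hw _ hcomp

/-- The compression of `s` to a finite-dimensional subspace has nuclear norm at most the sum of
the absolute values of its matrix entries. -/
theorem isNuclearWith_compression [CompleteSpace H] {U : Submodule ℝ H}
    [U.HasOrthogonalProjection] {κ : Type*} [Fintype κ] (e : OrthonormalBasis κ ℝ U)
    (s : H →L[ℝ] H) :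
    IsNuclearWith (∑ p : κ × κ, |⟪(e p.1 : H), s (e p.2)⟫|)
      (U.starProjection ∘L s ∘L U.starProjection) := by
  have hnorm (i : κ) : ‖(e i : H)‖ = 1 := e.orthonormal.1 i
  have h : IsNuclearExpansion (fun p : κ × κ => ⟪(e p.1 : H), s (e p.2)⟫ • (e p.1 : H))
      (fun p => (e p.2 : H)) (U.starProjection ∘L s ∘L U.starProjection) := by
    refine ⟨Summable.of_finite, fun z => ?_⟩
    have hz : (U.starProjection ∘L s ∘L U.starProjection) z =
        ∑ p : κ × κ, ⟪(e p.2 : H), z⟫ • ⟪(e p.1 : H), s (e p.2)⟫ • (e p.1 : H) := by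
      simp only [OrthonormalBasis.starProjection_eq_sum_rankOne e, Fintype.sum_prod_type,
        ContinuousLinearMap.comp_apply, sum_apply, InnerProductSpace.rankOne_apply, map_sum,
        map_smul, Finset.smul_sum]
      exact Finset.sum_comm
    rw [hz]
    exact hasSum_fintype _
  simpa [norm_smul, hnorm] using h.isNuclearWith

/-- Diagonal selection. -/
theorem exists_diagonal_tendsto {D : ℕ → ℕ → ℝ} (hD0 : ∀ k n, 0 ≤ D k n)
    (hD : ∀ k, Tendsto (D k) atTop (𝓝 0)) :
    ∃ k : ℕ → ℕ, Tendsto k atTop atTop ∧ Tendsto (fun n => D (k n) n) atTop (𝓝 0) := by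
  classical
  let k : ℕ → ℕ := fun n => Nat.findGreatest (fun j => D j n ≤ 1 / ((j : ℝ) + 1)) n
  have hsmall (j : ℕ) : ∀ᶠ n in atTop, D j n ≤ 1 / ((j : ℝ) + 1) :=
    (hD j).eventually_le_const (by positivity)
  have hk : Tendsto k atTop atTop := by
    refine tendsto_atTop.2 fun j => ?_
    filter_upwards [hsmall j, eventually_ge_atTop j] with n hn hjn
    exact Nat.le_findGreatest hjn hn
  refine ⟨k, hk, squeeze_zero' (Eventually.of_forall fun n => hD0 _ _) ?_
    (tendsto_one_div_add_atTop_nhds_zero_nat.comp hk)⟩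
  filter_upwards [hsmall 0] with n hn
  exact Nat.findGreatest_spec (P := fun j => D j n ≤ 1 / ((j : ℝ) + 1)) (Nat.zero_le n) hn

end

/- STATEMENT 5: if `tₑ → t` weak-* in `N[H]`, there are finite-rank orthogonal
projections `pₑ` with `pₑ tₑ pₑ → t` in trace norm and `qₑ tₑ qₑ → 0` weak-*,
where `qₑ = 1 − pₑ`. -/
theorem nuclear_projection_decomposition
    [NormedAddCommGroup H] [InnerProductSpace ℝ H] [CompleteSpace H]
    {ι : Type*} (b : HilbertBasis ι ℝ H)
    (ts : ℕ → H →L[ℝ] H) (t : H →L[ℝ] H)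
    (hts : ∀ n, IsNuclear (ts n)) (ht : IsNuclear t)
    (hw : WeakStarTendstoN b ts t) :
    ∃ p : ℕ → H →L[ℝ] H,
      (∀ n, IsIdempotentElem (p n) ∧ IsSelfAdjoint (p n) ∧
        FiniteDimensional ℝ (LinearMap.range (p n).toLinearMap)) ∧
      Filter.Tendsto (fun n => nuclearNorm (p n ∘L ts n ∘L p n - t)) Filter.atTop (nhds 0) ∧
      WeakStarTendstoN b (fun n => (1 - p n) ∘L ts n ∘L (1 - p n)) 0 := by
  choose x y hxy using fun n => (hts n).exists_expansion
  obtain ⟨x₀, y₀, hxy₀⟩ := ht.exists_expansion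
  obtain ⟨V, hmono, hfin, hV⟩ := exists_monotone_finiteDimensional
    (Sum.elim (Sum.elim x₀ y₀) (Sum.elim (fun p : ℕ × ℕ => x p.1 p.2) fun p : ℕ × ℕ => y p.1 p.2))
  let W := (⨆ k, V k).topologicalClosure
  have hW {z : H} (hz : z ∈ ⨆ k, V k) : W.starProjection z = z :=
    Submodule.starProjection_eq_self_iff.2 (Submodule.le_topologicalClosure _ hz)
  have hlim (z : H) :
      Tendsto (fun k => (V k).starProjection z) atTop (𝓝 (W.starProjection z)) :=
    Submodule.starProjection_tendsto_closure_iSup V hmono z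
  have hlim' {z : H} (hz : z ∈ ⨆ k, V k) :
      Tendsto (fun k => (V k).starProjection z) atTop (𝓝 z) := by
    have h := hlim z
    rwa [hW hz] at h
  have hx₀ (i : ℕ) : x₀ i ∈ ⨆ k, V k := hV (Sum.inl (Sum.inl i))
  have hy₀ (i : ℕ) : y₀ i ∈ ⨆ k, V k := hV (Sum.inl (Sum.inr i))
  have hx (n i : ℕ) : x n i ∈ ⨆ k, V k := hV (Sum.inr (Sum.inl (n, i)))
  have hy (n i : ℕ) : y n i ∈ ⨆ k, V k := hV (Sum.inr (Sum.inr (n, i)))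
  have hsa (k : ℕ) : (V k).starProjection.adjoint = (V k).starProjection :=
    isSelfAdjoint_starProjection (V k)
  let D : ℕ → ℕ → ℝ := fun k n =>
    ∑ p : Fin (Module.finrank ℝ (V k)) × Fin (Module.finrank ℝ (V k)),
      |⟪(stdOrthonormalBasis ℝ (V k) p.1 : H), (ts n - t) (stdOrthonormalBasis ℝ (V k) p.2)⟫|
  have hDnuc (k n : ℕ) : IsNuclearWith (D k n)
      ((V k).starProjection ∘L (ts n - t) ∘L (V k).starProjection) :=
    isNuclearWith_compression _ _
  have hD (k : ℕ) : Tendsto (D k) atTop (𝓝 0) := by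
    rw [← Finset.sum_const_zero (s := (Finset.univ :
      Finset (Fin (Module.finrank ℝ (V k)) × Fin (Module.finrank ℝ (V k)))))]
    refine tendsto_finsetSum _ fun p _ => ?_
    have := (hw.tendsto_inner hts ht (stdOrthonormalBasis ℝ (V k) p.1 : H)
      (stdOrthonormalBasis ℝ (V k) p.2)).sub_const
        ⟪(stdOrthonormalBasis ℝ (V k) p.1 : H), t (stdOrthonormalBasis ℝ (V k) p.2)⟫
    simpa [inner_sub_right] using this.abs
  obtain ⟨k, hk, hDk⟩ := exists_diagonal_tendsto (fun k n => (hDnuc k n).nonneg) hD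
  refine ⟨fun n => (V (k n)).starProjection, fun n => ⟨Submodule.isIdempotentElem_starProjection _,
    isSelfAdjoint_starProjection _, ?_⟩, ?_, ?_⟩
  · rw [Submodule.range_starProjection]
    exact hfin _
  · let E : ℕ → ℝ := fun j =>
      (∑' i, ‖(V j).starProjection (x₀ i) - x₀ i‖ * ‖(V j).starProjection (y₀ i)‖) +
        ∑' i, ‖x₀ i‖ * ‖(V j).starProjection (y₀ i) - y₀ i‖
    have hPle (j : ℕ) (z : H) : ‖(V j).starProjection z‖ ≤ ‖z‖ :=
      ((V j).starProjection.le_of_opNorm_le (V j).starProjection_norm_le z).trans (one_mul _).le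
    have hPsub (j : ℕ) (z : H) : ‖(V j).starProjection z - z‖ ≤ 2 * ‖z‖ := by
      linarith [norm_sub_le ((V j).starProjection z) z, hPle j z]
    have hb₁ (j i : ℕ) : ‖(V j).starProjection (x₀ i) - x₀ i‖ * ‖(V j).starProjection (y₀ i)‖ ≤
        2 * (‖x₀ i‖ * ‖y₀ i‖) := by
      rw [← mul_assoc]
      gcongr
      exacts [hPsub _ _, hPle _ _]
    have hb₂ (j i : ℕ) : ‖x₀ i‖ * ‖(V j).starProjection (y₀ i) - y₀ i‖ ≤
        2 * (‖x₀ i‖ * ‖y₀ i‖) := by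
      rw [mul_left_comm]
      gcongr
      exact hPsub _ _
    have hbd : Summable fun i => 2 * (‖x₀ i‖ * ‖y₀ i‖) := hxy₀.1.mul_left 2
    have hE : Tendsto E atTop (𝓝 0) := by
      have h₁ := tendsto_tsum_of_dominated_convergence (𝓕 := atTop)
        (f := fun j i => ‖(V j).starProjection (x₀ i) - x₀ i‖ * ‖(V j).starProjection (y₀ i)‖)
        (g := fun _ => (0 : ℝ)) hbd
        (fun i => by simpa using ((hlim' (hx₀ i)).sub_const (x₀ i)).norm.mul (hlim' (hy₀ i)).norm)
        (Eventually.of_forall fun j i => by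
          rw [Real.norm_of_nonneg (by positivity)]; exact hb₁ j i)
      have h₂ := tendsto_tsum_of_dominated_convergence (𝓕 := atTop)
        (f := fun j i => ‖x₀ i‖ * ‖(V j).starProjection (y₀ i) - y₀ i‖)
        (g := fun _ => (0 : ℝ)) hbd
        (fun i => by simpa using ((hlim' (hy₀ i)).sub_const (y₀ i)).norm.const_mul ‖x₀ i‖)
        (Eventually.of_forall fun j i => by
          rw [Real.norm_of_nonneg (by positivity)]; exact hb₂ j i)
      simpa using h₁.add h₂
    have hEnuc (j : ℕ) : IsNuclearWith (E j)
        ((V j).starProjection ∘L t ∘L (V j).starProjection - t) := by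
      have h₁ : IsNuclearExpansion (fun i => (V j).starProjection (x₀ i) - x₀ i)
          (fun i => (V j).starProjection (y₀ i))
          (((V j).starProjection - 1) ∘L t ∘L (V j).starProjection) := by
        simpa [hsa] using hxy₀.comp ((V j).starProjection - 1) (V j).starProjection
      have h₂ : IsNuclearExpansion x₀ (fun i => (V j).starProjection (y₀ i) - y₀ i)
          (t ∘L ((V j).starProjection - 1)) := by
        simpa [hsa, map_sub, ContinuousLinearMap.one_def, ContinuousLinearMap.adjoint_id] using
          hxy₀.comp (ContinuousLinearMap.id ℝ H) ((V j).starProjection - 1)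
      convert! h₁.isNuclearWith.add h₂.isNuclearWith using 1
      ext z
      simp
    refine squeeze_zero (fun n => nuclearNorm_nonneg _) (fun n => ?_)
      (by simpa using hDk.add (hE.comp hk))
    refine IsNuclearWith.nuclearNorm_le ?_
    convert! (hDnuc (k n) n).add (hEnuc (k n)) using 1
    ext z
    simp
  · intro a ha
    obtain ⟨M, hM0, hM⟩ := hw.exists_bound hts
    let R : ℕ → H →L[ℝ] H := fun j => W.starProjection - (V j).starProjection
    have hRsa (j : ℕ) : (R j).adjoint = R j := by
      simp only [R, map_sub, hsa]
      exact congrArg (· - (V j).starProjection) (isSelfAdjoint_starProjection W)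
    have hRnorm (j : ℕ) : ‖R j‖ ≤ 2 := by
      linarith [norm_sub_le W.starProjection (V j).starProjection,
        W.starProjection_norm_le, (V j).starProjection_norm_le]
    have hRlim (z : H) : Tendsto (fun j => R j z) atTop (𝓝 0) := by
      simpa [R] using (hlim z).const_sub (W.starProjection z)
    have hRa := (ha.tendsto_norm_comp hRnorm hRlim).comp hk
    have htrace (n : ℕ) : traceAlong b (a ∘L (1 - (V (k n)).starProjection) ∘L ts n ∘L
        (1 - (V (k n)).starProjection)) =
        traceAlong b ((R (k n) ∘L a ∘L R (k n)) ∘L ts n) := by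
      have hR {z : H} (hz : z ∈ ⨆ k, V k) :
          (1 - (V (k n)).starProjection).adjoint z = R (k n) z := by
        simp [R, hW hz, hsa, ContinuousLinearMap.one_def, ContinuousLinearMap.adjoint_id]
      have hR' {z : H} (hz : z ∈ ⨆ k, V k) :
          (1 - (V (k n)).starProjection) z = R (k n) z := by
        simp [R, hW hz]
      rw [((hxy n).comp_left _).traceAlong_eq b]
      refine (((hxy n).comp (a ∘L (1 - (V (k n)).starProjection)) _).traceAlong_eq b).trans
        (tsum_congr fun i => ?_)
      rw [hR (hy n i), ContinuousLinearMap.comp_apply, hR' (hx n i), ← hRsa (k n),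
        ContinuousLinearMap.adjoint_inner_right, hRsa]
      rfl
    simp only [ContinuousLinearMap.comp_zero, traceAlong_zero, htrace]
    refine squeeze_zero_norm (a := fun n => M * (‖R (k n) ∘L a‖ * 2)) (fun n => ?_)
      (by simpa using (hRa.mul_const 2).const_mul M)
    refine (hM n _ ((ha.comp_clm (R (k n))).clm_comp (R (k n)))).trans ?_
    gcongr
    exact (ContinuousLinearMap.opNorm_comp_le (R (k n) ∘L a) (R (k n))).trans
      (by gcongr; exact hRnorm _)
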